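/- arXiv:2504.19014 — 8 statements merged into one kernel-verified Lean document; each statement's English description precedes it below -/
import Mathlib

section
/- Let N ≥ 2 be an integer and let g : Fin N → EReal (e.g. g i may be the infimum of an arbitrary extended-real-valued function f_i over an arbitrary set A_i). Then sup over j of (inf over i ≠ j of g i) equals the infimum over all ordered pairs (i, j) with i ≠ j of max(g i, g j); in other words, both sides equal the second largest value among g 1, …, g N. -/
theorem iSup_iInf_ne_le_iInf_iInf_ne_max {ι α : Type*} [CompleteLinearOrder α] (g : ι → α) :
    (⨆ j, ⨅ i, ⨅ _ : i ≠ j, g i) ≤ ⨅ i, ⨅ j, ⨅ _ : i ≠ j, max (g i) (g j) := by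
  refine iSup_le fun k => le_iInf fun i => le_iInf fun j => le_iInf fun hij => ?_
  by_cases hik : i = k
  · exact (iInf₂_le j (hik ▸ hij.symm)).trans (le_max_right _ _)
  · exact (iInf₂_le i hik).trans (le_max_left _ _)

theorem iInf_iInf_ne_max_le_iSup_iInf_ne {ι α : Type*} [Finite ι] [Nonempty ι]
    [CompleteLinearOrder α] (g : ι → α) :
    (⨅ i, ⨅ j, ⨅ _ : i ≠ j, max (g i) (g j)) ≤ ⨆ j, ⨅ i, ⨅ _ : i ≠ j, g i := by
  obtain ⟨k, hk⟩ := Finite.exists_min g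
  refine le_iSup_of_le k (le_iInf₂ fun i hik => ?_)
  exact iInf_le_of_le i ((iInf₂_le k hik).trans (max_le le_rfl (hk i)))

/-- **Claim 1 (second-order statistic identity).**
For `N ≥ 2` and `g : Fin N → EReal`,
`⨆ j, ⨅ i ≠ j, g i = ⨅ (i j) (_ : i ≠ j), max (g i) (g j)`. -/
theorem stmt_0 (N : ℕ) (hN : 2 ≤ N) (g : Fin N → EReal) :
    (⨆ j : Fin N, ⨅ i : Fin N, ⨅ _ : i ≠ j, g i) =
      ⨅ i : Fin N, ⨅ j : Fin N, ⨅ _ : i ≠ j, max (g i) (g j) := by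
  have : Nonempty (Fin N) := ⟨⟨0, by lia⟩⟩
  exact (iSup_iInf_ne_le_iInf_iInf_ne_max g).antisymm (iInf_iInf_ne_max_le_iSup_iInf_ne g)
end

section
/- For every p ∈ ℝ^m, the upper and lower Hamiltonians of the differential game coincide (Isaacs condition): inf over Q : {1,…,K} → Δ_X of sup over w ∈ Δ_K of Σ_{a=1}^K w(a)·Σ_{i=1}^m p_i·D(Q_a‖ν^i_a) equals sup over w ∈ Δ_K of inf over Q : {1,…,K} → Δ_X of the same expression, and both equal max over a ∈ {1,…,K} of inf over q ∈ Δ_X of Σ_{i=1}^m p_i·D(q‖ν^i_a). -/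
/-- A probability mass function on a finite type. -/
def IsPMF {X : Type*} [Fintype X] (q : X → ℝ) : Prop :=
  (∀ x, 0 ≤ q x) ∧ ∑ x, q x = 1

/-- KL divergence between pmfs on a finite type (convention `0 · log 0 = 0`). -/
noncomputable def KL {X : Type*} [Fintype X] (q p : X → ℝ) : ℝ :=
  ∑ x, q x * Real.log (q x / p x)

lemma isPMF_single {ι : Type*} [Fintype ι] [DecidableEq ι] (a : ι) :
    IsPMF (Pi.single a 1 : ι → ℝ) := by
  refine ⟨fun b => ?_, by simp⟩
  by_cases h : b = a
  · subst h; simp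
  · simp [h]

lemma isCompact_setOf_isPMF (X : Type*) [Fintype X] : IsCompact {q : X → ℝ | IsPMF q} :=
  isCompact_stdSimplex ℝ X

lemma IsPMF.sum_mul_le {ι : Type*} [Fintype ι] {w g : ι → ℝ} (hw : IsPMF w) {M : ℝ}
    (hg : ∀ a, g a ≤ M) : ∑ a, w a * g a ≤ M := by
  calc ∑ a, w a * g a ≤ ∑ a, w a * M :=
        Finset.sum_le_sum fun a _ => mul_le_mul_of_nonneg_left (hg a) (hw.1 a)
    _ = M := by rw [← Finset.sum_mul, hw.2, one_mul]

lemma continuous_KL {X : Type*} [Fintype X] {p : X → ℝ} (hp : ∀ x, 0 < p x) :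
    Continuous fun q : X → ℝ => KL q p := by
  have h : (fun q : X → ℝ => KL q p) =
      fun q => ∑ x, (q x * Real.log (q x) - q x * Real.log (p x)) := by
    funext q
    refine Finset.sum_congr rfl fun x _ => ?_
    by_cases hq : q x = 0
    · simp [hq]
    · rw [Real.log_div hq (hp x).ne']; ring
  rw [h]
  exact continuous_finsetSum _ fun x _ =>
    (Real.continuous_mul_log.comp (continuous_apply x)).sub
      ((continuous_apply x).mul continuous_const)

/-- A weighted combination of divergences attains its minimum over probability mass functions,
whatever the signs of the weights. -/
lemma exists_forall_sum_mul_KL_le {X I : Type*} [Fintype X] [Nonempty X] [Fintype I]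
    {ν : I → X → ℝ} (hν : ∀ i x, 0 < ν i x) (p : I → ℝ) :
    ∃ q₀ : {q : X → ℝ // IsPMF q}, ∀ q : {q : X → ℝ // IsPMF q},
      ∑ i, p i * KL q₀.1 (ν i) ≤ ∑ i, p i * KL q.1 (ν i) := by
  classical
  have hc : Continuous fun q : X → ℝ => ∑ i, p i * KL q (ν i) :=
    continuous_finsetSum _ fun i _ => continuous_const.mul (continuous_KL (hν i))
  obtain ⟨q₀, hq₀, hmin⟩ := (isCompact_setOf_isPMF X).exists_isMinOn
    ⟨_, isPMF_single (Classical.arbitrary X)⟩ hc.continuousOn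
  exact ⟨⟨q₀, hq₀⟩, fun q => hmin q.2⟩

section Minimax

variable {ι Y : Type*} [Fintype ι] [Nonempty ι] {f : ι → Y → ℝ} {y₀ : ι → Y}

lemma iInf_iSup_sum_mul_eq (hf : ∀ a y, f a (y₀ a) ≤ f a y) :
    (⨅ Q : ι → Y, ⨆ w : {w : ι → ℝ // IsPMF w}, ∑ a, w.1 a * f a (Q a)) =
      ⨆ a, f a (y₀ a) := by
  classical
  have : Nonempty {w : ι → ℝ // IsPMF w} := ⟨⟨_, isPMF_single (Classical.arbitrary ι)⟩⟩
  have : Nonempty (ι → Y) := ⟨y₀⟩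
  have hle (g : ι → ℝ) (w : {w : ι → ℝ // IsPMF w}) : ∑ a, w.1 a * g a ≤ ⨆ a, g a :=
    w.2.sum_mul_le (le_ciSup (Finite.bddAbove_range g))
  have hlow (Q : ι → Y) : (⨆ a, f a (y₀ a)) ≤
      ⨆ w : {w : ι → ℝ // IsPMF w}, ∑ a, w.1 a * f a (Q a) := by
    refine ciSup_le fun a => (hf a (Q a)).trans ?_
    refine le_ciSup_of_le ⟨_, Set.forall_mem_range.2 (hle fun a => f a (Q a))⟩
      ⟨_, isPMF_single a⟩ ?_
    simp [Pi.single_apply]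
  exact le_antisymm
    (ciInf_le_of_le ⟨_, Set.forall_mem_range.2 hlow⟩ y₀ (ciSup_le (hle fun a => f a (y₀ a))))
    (le_ciInf hlow)

lemma iSup_iInf_sum_mul_eq (hf : ∀ a y, f a (y₀ a) ≤ f a y) :
    (⨆ w : {w : ι → ℝ // IsPMF w}, ⨅ Q : ι → Y, ∑ a, w.1 a * f a (Q a)) =
      ⨆ a, f a (y₀ a) := by
  classical
  have : Nonempty {w : ι → ℝ // IsPMF w} := ⟨⟨_, isPMF_single (Classical.arbitrary ι)⟩⟩
  have : Nonempty (ι → Y) := ⟨y₀⟩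
  have hinner (w : {w : ι → ℝ // IsPMF w}) :
      (⨅ Q : ι → Y, ∑ a, w.1 a * f a (Q a)) = ∑ a, w.1 a * f a (y₀ a) := by
    have h (Q : ι → Y) : ∑ a, w.1 a * f a (y₀ a) ≤ ∑ a, w.1 a * f a (Q a) :=
      Finset.sum_le_sum fun a _ => mul_le_mul_of_nonneg_left (hf a (Q a)) (w.2.1 a)
    exact le_antisymm (ciInf_le ⟨_, Set.forall_mem_range.2 h⟩ y₀) (le_ciInf h)
  simp_rw [hinner]
  have hle (w : {w : ι → ℝ // IsPMF w}) : ∑ a, w.1 a * f a (y₀ a) ≤ ⨆ a, f a (y₀ a) :=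
    w.2.sum_mul_le (le_ciSup (Finite.bddAbove_range fun a => f a (y₀ a)))
  refine le_antisymm (ciSup_le hle) (ciSup_le fun a => ?_)
  refine le_ciSup_of_le ⟨_, Set.forall_mem_range.2 hle⟩ ⟨_, isPMF_single a⟩ ?_
  simp [Pi.single_apply]

end Minimax

/-- **Isaacs condition (Lemma 1 of the paper, first assertion).**
The upper and lower Hamiltonians coincide and both equal
`max_a inf_q Σ_i p_i D(q ‖ ν^i_a)`. -/
theorem stmt_1 {X : Type*} [Fintype X] [Nonempty X] (K m : ℕ) (hK : 1 ≤ K) (hm : 2 ≤ m)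
    (ν : Fin m → Fin K → X → ℝ) (hν : ∀ i a, IsPMF (ν i a))
    (hfull : ∀ i a x, 0 < ν i a x) (p : Fin m → ℝ) :
    ((⨅ Q : Fin K → {q : X → ℝ // IsPMF q}, ⨆ w : {w : Fin K → ℝ // IsPMF w},
        ∑ a, w.1 a * ∑ i, p i * KL (Q a).1 (ν i a)) =
      ⨆ w : {w : Fin K → ℝ // IsPMF w}, ⨅ Q : Fin K → {q : X → ℝ // IsPMF q},
        ∑ a, w.1 a * ∑ i, p i * KL (Q a).1 (ν i a)) ∧
    ((⨅ Q : Fin K → {q : X → ℝ // IsPMF q}, ⨆ w : {w : Fin K → ℝ // IsPMF w},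
        ∑ a, w.1 a * ∑ i, p i * KL (Q a).1 (ν i a)) =
      ⨆ a : Fin K, ⨅ q : {q : X → ℝ // IsPMF q}, ∑ i, p i * KL q.1 (ν i a)) := by
  have : Nonempty (Fin K) := ⟨⟨0, hK⟩⟩
  choose q₀ hq₀ using fun a =>
    exists_forall_sum_mul_KL_le (ν := fun i => ν i a) (fun i => hfull i a) p
  have hupper := iInf_iSup_sum_mul_eq
    (f := fun a (q : {q : X → ℝ // IsPMF q}) => ∑ i, p i * KL q.1 (ν i a)) hq₀
  have hlower := iSup_iInf_sum_mul_eq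
    (f := fun a (q : {q : X → ℝ // IsPMF q}) => ∑ i, p i * KL q.1 (ν i a)) hq₀
  refine ⟨hupper.trans hlower.symm, hupper.trans (iSup_congr fun a => ?_)⟩
  have : Nonempty {q : X → ℝ // IsPMF q} := ⟨q₀ a⟩
  exact le_antisymm (le_ciInf (hq₀ a)) (ciInf_le ⟨_, Set.forall_mem_range.2 (hq₀ a)⟩ (q₀ a))
end

section
/- Let μ_1, …, μ_m be full-support probability mass functions on a nonempty finite set X and let p ∈ ℝ^m with P := Σ_{i=1}^m p_i > 0. Then inf over q ∈ Δ_X of Σ_{i=1}^m p_i·D(q‖μ_i) equals −P·log(Σ_{x∈X} Π_{i=1}^m μ_i(x)^{p_i/P}), and the infimum is attained at the normalized geometric mixture q*(x) = Π_{i=1}^m μ_i(x)^{p_i/P} / (Σ_{x'∈X} Π_{i=1}^m μ_i(x')^{p_i/P}). -/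
/-- Gibbs' inequality on a finite type. -/
lemma KL_nonneg {X : Type*} [Fintype X] {q r : X → ℝ} (hq : IsPMF q) (hr : IsPMF r)
    (hpos : ∀ x, 0 < r x) : 0 ≤ KL q r := by
  have key : ∀ x, q x - r x ≤ q x * Real.log (q x / r x) := by
    intro x
    rcases (hq.1 x).eq_or_lt with h | h
    · simp [← h, (hpos x).le]
    · have h1 := Real.one_sub_inv_le_log_of_pos (div_pos h (hpos x))
      calc q x - r x = q x * (1 - (q x / r x)⁻¹) := by field_simp
        _ ≤ _ := mul_le_mul_of_nonneg_left h1 h.le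
  calc (0 : ℝ) = ∑ x, (q x - r x) := by rw [Finset.sum_sub_distrib, hq.2, hr.2, sub_self]
    _ ≤ _ := Finset.sum_le_sum fun x _ => key x

lemma KL_self {X : Type*} [Fintype X] {q : X → ℝ} (hpos : ∀ x, 0 < q x) : KL q q = 0 := by
  simp [KL, div_self (hpos _).ne']

/-- A weighted sum of divergences is, up to a constant, the divergence from the normalized
geometric mixture. -/
lemma sum_mul_KL_eq {X ι : Type*} [Fintype X] [Fintype ι] {μ : ι → X → ℝ}
    (hfull : ∀ i x, 0 < μ i x) {p : ι → ℝ} (hP : ∑ i, p i ≠ 0) {Z : ℝ} (hZ : 0 < Z)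
    {q : X → ℝ} (hq : IsPMF q) :
    ∑ i, p i * KL q (μ i) =
      (∑ i, p i) * KL q (fun x => (∏ i, μ i x ^ (p i / ∑ j, p j)) / Z) -
        (∑ i, p i) * Real.log Z := by
  have key : ∀ x, ∑ i, p i * (q x * Real.log (q x / μ i x)) =
      (∑ i, p i) * (q x * Real.log (q x / ((∏ i, μ i x ^ (p i / ∑ j, p j)) / Z))) -
        (∑ i, p i) * Real.log Z * q x := by
    intro x
    rcases (hq.1 x).eq_or_lt with h | h
    · simp [← h]
    have hg : 0 < ∏ i, μ i x ^ (p i / ∑ j, p j) :=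
      Finset.prod_pos fun i _ => Real.rpow_pos_of_pos (hfull i x) _
    have hlog : (∑ i, p i) * Real.log (∏ i, μ i x ^ (p i / ∑ j, p j)) =
        ∑ i, p i * Real.log (μ i x) := by
      rw [Real.log_prod fun i _ => (Real.rpow_pos_of_pos (hfull i x) _).ne', Finset.mul_sum]
      refine Finset.sum_congr rfl fun i _ => ?_
      rw [Real.log_rpow (hfull i x)]
      field_simp
    have hsum : ∑ i, p i * (q x * Real.log (q x / μ i x)) =
        q x * ((∑ i, p i) * Real.log (q x) - ∑ i, p i * Real.log (μ i x)) := by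
      rw [Finset.sum_mul, ← Finset.sum_sub_distrib, Finset.mul_sum]
      refine Finset.sum_congr rfl fun i _ => ?_
      rw [Real.log_div h.ne' (hfull i x).ne']
      ring
    rw [hsum, ← hlog, Real.log_div h.ne' (div_pos hg hZ).ne', Real.log_div hg.ne' hZ.ne']
    ring
  simp only [KL, Finset.mul_sum (s := (Finset.univ : Finset X))]
  rw [Finset.sum_comm, Finset.sum_congr rfl fun x _ => key x, Finset.sum_sub_distrib,
    ← Finset.mul_sum _ q, hq.2, mul_one]

/-- **Case `P > 0` of the Hamiltonian formula (Lemma 1 of the paper).**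
If `P = Σ p_i > 0`, then `inf_{q ∈ Δ_X} Σ p_i D(q ‖ μ_i) = −P log Σ_x Π_i μ_i(x)^{p_i/P}`,
and the infimum is attained at the normalized geometric mixture. -/
theorem stmt_2 {X : Type*} [Fintype X] [Nonempty X] (m : ℕ) (μ : Fin m → X → ℝ)
    (hμ : ∀ i, IsPMF (μ i)) (hfull : ∀ i x, 0 < μ i x)
    (p : Fin m → ℝ) (hP : 0 < ∑ i, p i) :
    ((⨅ q : {q : X → ℝ // IsPMF q}, ∑ i, p i * KL q.1 (μ i)) =
      -(∑ i, p i) * Real.log (∑ x, ∏ i, μ i x ^ (p i / ∑ j, p j))) ∧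
    IsPMF (fun x => (∏ i, μ i x ^ (p i / ∑ j, p j)) /
        ∑ x', ∏ i, μ i x' ^ (p i / ∑ j, p j)) ∧
    (∑ i, p i * KL (fun x => (∏ i', μ i' x ^ (p i' / ∑ j, p j)) /
        ∑ x', ∏ i', μ i' x' ^ (p i' / ∑ j, p j)) (μ i)) =
      -(∑ i, p i) * Real.log (∑ x, ∏ i, μ i x ^ (p i / ∑ j, p j)) := by
  have hg : ∀ x, 0 < ∏ i, μ i x ^ (p i / ∑ j, p j) := fun x =>
    Finset.prod_pos fun i _ => Real.rpow_pos_of_pos (hfull i x) _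
  have hZ : 0 < ∑ x, ∏ i, μ i x ^ (p i / ∑ j, p j) :=
    Finset.sum_pos (fun x _ => hg x) Finset.univ_nonempty
  have hpos := fun x => div_pos (hg x) hZ
  have hpmf : IsPMF (fun x => (∏ i, μ i x ^ (p i / ∑ j, p j)) /
      ∑ x', ∏ i, μ i x' ^ (p i / ∑ j, p j)) :=
    ⟨fun x => (hpos x).le, by rw [← Finset.sum_div, div_self hZ.ne']⟩
  have hval := sum_mul_KL_eq hfull hP.ne' hZ hpmf
  rw [KL_self hpos, mul_zero, zero_sub, ← neg_mul] at hval
  refine ⟨?_, hpmf, hval⟩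
  have hle : ∀ q : {q : X → ℝ // IsPMF q},
      -(∑ i, p i) * Real.log (∑ x, ∏ i, μ i x ^ (p i / ∑ j, p j)) ≤
        ∑ i, p i * KL q.1 (μ i) := by
    intro q
    rw [sum_mul_KL_eq hfull hP.ne' hZ q.2]
    linarith [mul_nonneg hP.le (KL_nonneg q.2 hpmf hpos)]
  have : Nonempty {q : X → ℝ // IsPMF q} := ⟨⟨_, hpmf⟩⟩
  refine le_antisymm ?_ (le_ciInf hle)
  exact (ciInf_le ⟨_, Set.forall_mem_range.2 hle⟩ ⟨_, hpmf⟩).trans_eq hval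
end

section
/- Let μ_1, …, μ_m be full-support probability mass functions on a nonempty finite set X and let p ∈ ℝ^m with Σ_{i=1}^m p_i ≤ 0. Then inf over q ∈ Δ_X of Σ_{i=1}^m p_i·D(q‖μ_i) equals min over x ∈ X of (−Σ_{i=1}^m p_i·log μ_i(x)). -/
/-- A pmf on a finite type has nonnegative entropy. -/
lemma IsPMF.sum_mul_log_nonpos {X : Type*} [Fintype X] {q : X → ℝ} (hq : IsPMF q) :
    ∑ x, q x * Real.log (q x) ≤ 0 := by
  refine Finset.sum_nonpos fun x _ => Real.mul_log_nonpos (hq.1 x) ?_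
  exact hq.2 ▸ Finset.single_le_sum (fun y _ => hq.1 y) (Finset.mem_univ x)

lemma isPMF_pi_single {X : Type*} [Fintype X] [DecidableEq X] (x : X) :
    IsPMF (Pi.single x (1 : ℝ)) :=
  ⟨fun y => by rw [Pi.single_apply]; positivity, by simp⟩

lemma KL_eq_sum_sub_sum {X : Type*} [Fintype X] (q : X → ℝ) {p : X → ℝ} (hp : ∀ x, 0 < p x) :
    KL q p = ∑ x, q x * Real.log (q x) - ∑ x, q x * Real.log (p x) := by
  rw [KL, ← Finset.sum_sub_distrib]
  refine Finset.sum_congr rfl fun x _ => ?_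
  rcases eq_or_ne (q x) 0 with h | h
  · simp [h]
  · rw [Real.log_div h (hp x).ne', mul_sub]

/-- A linear combination of KL divergences splits into an entropy term and a linear term. -/
lemma sum_mul_KL {X ι : Type*} [Fintype X] [Fintype ι] (q : X → ℝ) {μ : ι → X → ℝ}
    (hfull : ∀ i x, 0 < μ i x) (p : ι → ℝ) :
    ∑ i, p i * KL q (μ i) = (∑ i, p i) * ∑ x, q x * Real.log (q x) +
      ∑ x, q x * -∑ i, p i * Real.log (μ i x) := by
  have linear : ∑ x, q x * -∑ i, p i * Real.log (μ i x) =
      -∑ i, p i * ∑ x, q x * Real.log (μ i x) := by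
    simp only [mul_neg, Finset.sum_neg_distrib, Finset.mul_sum]
    rw [Finset.sum_comm]
    simp only [mul_left_comm]
  simp only [KL_eq_sum_sub_sum q (hfull _), mul_sub, Finset.sum_sub_distrib, linear,
    Finset.sum_mul, ← sub_eq_add_neg]

/-- **Case `P ≤ 0` of the Hamiltonian formula (Lemma 1 of the paper).**
If `Σ p_i ≤ 0`, then `inf_{q ∈ Δ_X} Σ p_i D(q ‖ μ_i) = min_x (−Σ_i p_i log μ_i(x))`. -/
theorem stmt_3 {X : Type*} [Fintype X] [Nonempty X] (m : ℕ) (μ : Fin m → X → ℝ)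
    (hμ : ∀ i, IsPMF (μ i)) (hfull : ∀ i x, 0 < μ i x)
    (p : Fin m → ℝ) (hP : ∑ i, p i ≤ 0) :
    (⨅ q : {q : X → ℝ // IsPMF q}, ∑ i, p i * KL q.1 (μ i)) =
      ⨅ x : X, -∑ i, p i * Real.log (μ i x) := by
  classical
  have lower (q : {q : X → ℝ // IsPMF q}) :
      ⨅ x : X, -∑ i, p i * Real.log (μ i x) ≤ ∑ i, p i * KL q.1 (μ i) := by
    rw [sum_mul_KL q.1 hfull p]
    calc ⨅ x : X, -∑ i, p i * Real.log (μ i x)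
        = ∑ y, q.1 y * ⨅ x : X, -∑ i, p i * Real.log (μ i x) := by
          rw [← Finset.sum_mul, q.2.2, one_mul]
      _ ≤ ∑ y, q.1 y * -∑ i, p i * Real.log (μ i y) :=
          Finset.sum_le_sum fun y _ =>
            mul_le_mul_of_nonneg_left (ciInf_le (Set.finite_range _).bddBelow y) (q.2.1 y)
      _ ≤ _ := le_add_of_nonneg_left
          (mul_nonneg_of_nonpos_of_nonpos hP q.2.sum_mul_log_nonpos)
  have : Nonempty {q : X → ℝ // IsPMF q} :=
    ⟨⟨_, isPMF_pi_single (Classical.arbitrary X)⟩⟩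
  refine le_antisymm (le_ciInf fun x => ?_) (le_ciInf lower)
  refine (ciInf_le ⟨_, Set.forall_mem_range.2 lower⟩ ⟨_, isPMF_pi_single x⟩).trans_eq ?_
  rw [sum_mul_KL _ hfull p]
  simp [Pi.single_apply]
end

section
/- Let μ_1, …, μ_m be full-support probability mass functions on a nonempty finite set X. On the open set {p ∈ ℝ^m : Σ_i p_i > 0}, the function F(p) = −(Σ_i p_i)·log(Σ_{x∈X} Π_{i=1}^m μ_i(x)^{p_i/(Σ_i p_i)}) is differentiable, and its partial derivative in the j-th coordinate at p equals D(S(p)‖μ_j), where S(p) ∈ Δ_X is the normalized geometric mixture S(p)(x) = Π_{i=1}^m μ_i(x)^{p_i/(Σ_i p_i)} / (Σ_{x'∈X} Π_{i=1}^m μ_i(x')^{p_i/(Σ_i p_i)}). -/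
/-- The normalized geometric mixture `S(p)(x) = Π_i μ_i(x)^{p_i/P} / Σ_{x'} Π_i μ_i(x')^{p_i/P}`. -/
noncomputable def geomMix {X : Type*} [Fintype X] {m : ℕ} (μ : Fin m → X → ℝ)
    (p : Fin m → ℝ) (x : X) : ℝ :=
  (∏ i, μ i x ^ (p i / ∑ j, p j)) / ∑ x', ∏ i, μ i x' ^ (p i / ∑ j, p j)

/-- The per-arm Hamiltonian formula `F(p) = −(Σ_i p_i)·log Σ_x Π_i μ_i(x)^{p_i/Σ p}`. -/
noncomputable def Fham {X : Type*} [Fintype X] {m : ℕ} (μ : Fin m → X → ℝ)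
    (p : Fin m → ℝ) : ℝ :=
  -(∑ i, p i) * Real.log (∑ x, ∏ i, μ i x ^ (p i / ∑ j, p j))

/-- The weighted product of positive numbers as the exponential of an arithmetic mean of logs. -/
lemma prod_rpow_div_eq_exp {ι : Type*} [Fintype ι] (a : ι → ℝ) (ha : ∀ i, 0 < a i)
    (p : ι → ℝ) (s : ℝ) :
    ∏ i, a i ^ (p i / s) = Real.exp ((∑ i, p i * Real.log (a i)) / s) := by
  rw [Finset.sum_div, Real.exp_sum]
  refine Finset.prod_congr rfl fun i _ => ?_
  rw [Real.rpow_def_of_pos (ha i)]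
  congr 1
  ring

/-- The derivative of the perspective `q ↦ -P q * log (∑ x, exp (L x q / P q))` of a
log-sum-exp function, for linear functionals `P` and `L x`. -/
lemma hasFDerivAt_neg_mul_log_sum_exp_div {X E : Type*} [Fintype X] [Nonempty X]
    [NormedAddCommGroup E] [NormedSpace ℝ E] (P : E →L[ℝ] ℝ) (L : X → E →L[ℝ] ℝ)
    {p : E} (hp : P p ≠ 0) :
    HasFDerivAt (fun q => -P q * Real.log (∑ x, Real.exp (L x q / P q)))
      (-Real.log (∑ x, Real.exp (L x p / P p)) • P -
        ∑ x, (Real.exp (L x p / P p) / ∑ y, Real.exp (L y p / P p)) •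
          (L x - (L x p / P p) • P)) p := by
  have hZ : 0 < ∑ x, Real.exp (L x p / P p) :=
    Finset.sum_pos (fun x _ => Real.exp_pos _) Finset.univ_nonempty
  have hdiv (x : X) : HasFDerivAt (fun q => L x q / P q)
      ((P p)⁻¹ • (L x - (L x p / P p) • P)) p := by
    have hinv : HasFDerivAt (fun q => (P q)⁻¹) _ p :=
      (hasDerivAt_inv hp).comp_hasFDerivAt p P.hasFDerivAt
    simp only [div_eq_mul_inv]
    refine (HasFDerivAt.fun_mul (L x).hasFDerivAt hinv).congr_fderiv ?_
    ext v
    simp only [add_apply, sub_apply, smul_apply, smul_eq_mul]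
    field_simp
    ring
  have hsum : HasFDerivAt (fun q => ∑ x, Real.exp (L x q / P q)) _ p :=
    HasFDerivAt.fun_sum fun x _ => (hdiv x).exp
  refine (HasFDerivAt.fun_mul (HasFDerivAt.fun_neg P.hasFDerivAt) (hsum.log hZ.ne')).congr_fderiv ?_
  ext v
  simp only [add_apply, sub_apply,
    neg_apply, smul_apply,
    sum_apply, smul_eq_mul]
  rw [Finset.mul_sum, Finset.mul_sum, sub_eq_add_neg, ← Finset.sum_neg_distrib, add_comm]
  congr 1
  · ring
  · refine Finset.sum_congr rfl fun x _ => ?_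
    field_simp

/-- **Gradient of the per-arm Hamiltonian (proof of Lemma 1 of the paper).**
On `{Σ p_i > 0}`, `F` is differentiable and `∂F/∂p_j (p) = D(S(p) ‖ μ_j)`. -/
theorem stmt_6 {X : Type*} [Fintype X] [Nonempty X] (m : ℕ) (μ : Fin m → X → ℝ)
    (hμ : ∀ i, IsPMF (μ i)) (hfull : ∀ i x, 0 < μ i x)
    (p : Fin m → ℝ) (hp : 0 < ∑ i, p i) :
    DifferentiableAt ℝ (Fham μ) p ∧
      ∀ j, fderiv ℝ (Fham μ) p (Pi.single j 1) = KL (geomMix μ p) (μ j) := by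
  set P : (Fin m → ℝ) →L[ℝ] ℝ := ∑ i, ContinuousLinearMap.proj i with hP
  set L : X → (Fin m → ℝ) →L[ℝ] ℝ :=
    fun x => ∑ i, Real.log (μ i x) • ContinuousLinearMap.proj i with hL
  have hPapp (q : Fin m → ℝ) : P q = ∑ i, q i := by
    simp [hP]
  have hLapp (x : X) (q : Fin m → ℝ) : L x q = ∑ i, q i * Real.log (μ i x) := by
    simp [hL, mul_comm]
  have hprod (q : Fin m → ℝ) (x : X) :
      ∏ i, μ i x ^ (q i / ∑ j, q j) = Real.exp (L x q / P q) := by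
    rw [prod_rpow_div_eq_exp _ (fun i => hfull i x), hLapp, hPapp]
  have hF : Fham μ = fun q => -P q * Real.log (∑ x, Real.exp (L x q / P q)) := by
    funext q
    simp only [Fham, hprod, hPapp]
  have hP0 : P p ≠ 0 := by rw [hPapp]; exact hp.ne'
  have hderiv := hasFDerivAt_neg_mul_log_sum_exp_div P L hP0
  rw [← hF] at hderiv
  refine ⟨hderiv.differentiableAt, fun j => ?_⟩
  have hPj : P (Pi.single j 1) = 1 := by simp [hPapp]
  have hLj (x : X) : L x (Pi.single j 1) = Real.log (μ j x) := by
    simp [hLapp, Pi.single_apply]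
  have hZ : 0 < ∑ x, Real.exp (L x p / P p) :=
    Finset.sum_pos (fun x _ => Real.exp_pos _) Finset.univ_nonempty
  rw [hderiv.fderiv]
  simp only [sub_apply, smul_apply,
    sum_apply, smul_eq_mul, hPj, hLj, KL, geomMix, hprod, mul_one]
  set Z := ∑ x, Real.exp (L x p / P p) with hZdef
  have hone : ∑ x, Real.exp (L x p / P p) / Z = 1 := by
    rw [← Finset.sum_div, div_self hZ.ne']
  have hlog (x : X) : Real.log (Real.exp (L x p / P p) / Z / μ j x) =
      -Real.log Z - (Real.log (μ j x) - L x p / P p) := by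
    rw [Real.log_div (div_pos (Real.exp_pos _) hZ).ne' (hfull j x).ne',
      Real.log_div (Real.exp_pos _).ne' hZ.ne', Real.log_exp]
    ring
  simp only [hlog, mul_sub _ (-Real.log Z), Finset.sum_sub_distrib]
  rw [← Finset.sum_mul, hone, one_mul]
end

section
/- Let m ≥ 1 and a, κ, Δt, Δh > 0, and let B ∈ ℕ with B·Δt = 1. For 0 ≤ l ≤ B set t_l = l·Δt. Define the spatial grid GR_{Δh} = {x ∈ ℝ^m : ‖x‖_∞ ≤ √m·a + κ and each coordinate x_i is an integer multiple of Δh}, and for each l the set D_l = {x ∈ GR_{Δh} : ‖x‖₂ ≤ √m·a·t_l + κ·t_l²}. If Δh < κ·(Δt)²/√m, then for every l ∈ {0, 1, …, B−1}, the union over x ∈ D_l of the closed Euclidean balls of radius √m·a·Δt centered at x is contained in the convex hull of D_{l+1}. -/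
/-- Triangle inequality for the Euclidean norm of a function on a finite type. -/
lemma sqrt_sum_sq_le_add {ι : Type*} [Fintype ι] (u v : ι → ℝ) :
    Real.sqrt (∑ i, u i ^ 2) ≤ Real.sqrt (∑ i, v i ^ 2) + Real.sqrt (∑ i, (u i - v i) ^ 2) := by
  have h := norm_add_le (WithLp.toLp 2 v) (WithLp.toLp 2 (u - v))
  rw [← WithLp.toLp_add, add_sub_cancel] at h
  simpa [EuclideanSpace.norm_eq] using h

lemma abs_le_sqrt_sum_sq {ι : Type*} [Fintype ι] (u : ι → ℝ) (i : ι) :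
    |u i| ≤ Real.sqrt (∑ j, u j ^ 2) :=
  Real.abs_le_sqrt (Finset.single_le_sum (f := fun j => u j ^ 2)
    (fun j _ => sq_nonneg (u j)) (Finset.mem_univ i))

lemma sqrt_sum_sq_le_of_abs_le {m : ℕ} {u : Fin m → ℝ} {c : ℝ} (hc : 0 ≤ c)
    (hu : ∀ i, |u i| ≤ c) : Real.sqrt (∑ i, u i ^ 2) ≤ Real.sqrt m * c := by
  refine Real.sqrt_le_iff.2 ⟨by positivity, ?_⟩
  rw [mul_pow, Real.sq_sqrt (Nat.cast_nonneg m)]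
  calc ∑ i, u i ^ 2 ≤ ∑ _i : Fin m, c ^ 2 :=
        Finset.sum_le_sum fun i _ => sq_le_sq' (abs_le.1 (hu i)).1 (abs_le.1 (hu i)).2
    _ = m * c ^ 2 := by simp

/-- A point lies in the convex hull of the vertices of its cell in the grid `(h ℤ)^ι`. -/
lemma mem_convexHull_grid {ι : Type*} [Finite ι] {h : ℝ} (hh : 0 < h) (y : ι → ℝ) :
    y ∈ convexHull ℝ {z : ι → ℝ | ∀ i, |z i - y i| ≤ h ∧ ∃ n : ℤ, z i = n * h} := by
  have hfl (i : ι) : ⌊y i / h⌋ * h ≤ y i := (le_div_iff₀ hh).1 (Int.floor_le _)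
  have hlt (i : ι) : y i < (⌊y i / h⌋ + 1) * h := (div_lt_iff₀ hh).1 (Int.lt_floor_add_one _)
  have hy : y ∈ convexHull ℝ (Set.univ.pi fun i =>
      ({⌊y i / h⌋ * h, (⌊y i / h⌋ + 1) * h} : Set ℝ)) := by
    rw [convexHull_pi]
    intro i _
    beta_reduce
    rw [convexHull_pair, segment_eq_Icc (by linarith [hfl i, hlt i])]
    exact ⟨hfl i, (hlt i).le⟩
  refine convexHull_mono (fun z hz i => ?_) hy
  rcases hz i (Set.mem_univ i) with hzi | hzi
  · exact ⟨abs_le.2 ⟨by linarith [hlt i], by linarith [hfl i]⟩, _, hzi⟩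
  · have hzi' : z i = (⌊y i / h⌋ + 1) * h := hzi
    exact ⟨abs_le.2 ⟨by linarith [hlt i], by linarith [hfl i]⟩, ⌊y i / h⌋ + 1, by
      rw [hzi']; push_cast; ring⟩

/-- **Lemma 6 of the paper (consistency of the spatio-temporal grid).**
With `GR_{Δh}` the spatial grid of mesh `Δh` in the box `‖x‖_∞ ≤ √m·a + κ` and
`D_l = GR_{Δh} ∩ {‖x‖₂ ≤ √m·a·t_l + κ·t_l²}` (`t_l = l·Δt`), if `Δh < κ·Δt²/√m`
then for every `l < B`, the union of closed Euclidean balls of radius `√m·a·Δt`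
centered at points of `D_l` is contained in the convex hull of `D_{l+1}`. -/
theorem stmt_10 (m : ℕ) (hm : 1 ≤ m) (a κ Δt Δh : ℝ)
    (ha : 0 < a) (hκ : 0 < κ) (hΔt : 0 < Δt) (hΔh : 0 < Δh)
    (B : ℕ) (hB : (B : ℝ) * Δt = 1)
    (GR : Set (Fin m → ℝ))
    (hGR : GR = {x | (∀ i, |x i| ≤ Real.sqrt m * a + κ) ∧ ∀ i, ∃ n : ℤ, x i = n * Δh})
    (D : ℕ → Set (Fin m → ℝ))
    (hD : ∀ l : ℕ, D l = {x ∈ GR |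
      Real.sqrt (∑ i, x i ^ 2) ≤ Real.sqrt m * a * (l * Δt) + κ * (l * Δt) ^ 2})
    (hstep : Δh < κ * Δt ^ 2 / Real.sqrt m) :
    ∀ l < B, ∀ x ∈ D l, ∀ y : Fin m → ℝ,
      Real.sqrt (∑ i, (y i - x i) ^ 2) ≤ Real.sqrt m * a * Δt →
        y ∈ convexHull ℝ (D (l + 1)) := by
  intro l hl x hx y hxy
  rw [hD] at hx
  have hx2 := hx.2
  refine convexHull_mono (fun z hz => ?_) (mem_convexHull_grid hΔh y)
  have hsm : 0 < Real.sqrt m := Real.sqrt_pos.2 (by exact_mod_cast hm)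
  have hmesh : Real.sqrt m * Δh < κ * Δt ^ 2 := by
    rw [mul_comm]
    exact (lt_div_iff₀ hsm).1 hstep
  have hzy : Real.sqrt (∑ i, (z i - y i) ^ 2) ≤ Real.sqrt m * Δh :=
    sqrt_sum_sq_le_of_abs_le (u := fun i => z i - y i) hΔh.le fun i => (hz i).1
  have hlΔt : (0 : ℝ) ≤ l * Δt := by positivity
  have hnorm : Real.sqrt (∑ i, z i ^ 2) ≤
      Real.sqrt m * a * ((l + 1 : ℕ) * Δt) + κ * ((l + 1 : ℕ) * Δt) ^ 2 := by
    have hcross : 0 ≤ κ * (2 * (l * Δt) * Δt) := by positivity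
    push_cast
    linarith [sqrt_sum_sq_le_add z y, sqrt_sum_sq_le_add y x]
  have htime : ((l + 1 : ℕ) : ℝ) * Δt ≤ 1 := by
    rw [← hB]
    exact mul_le_mul_of_nonneg_right (by exact_mod_cast hl) hΔt.le
  have htime0 : 0 ≤ ((l + 1 : ℕ) : ℝ) * Δt := by positivity
  have hbox : Real.sqrt m * a * ((l + 1 : ℕ) * Δt) + κ * ((l + 1 : ℕ) * Δt) ^ 2 ≤
      Real.sqrt m * a + κ :=
    add_le_add (mul_le_of_le_one_right (by positivity) htime)
      (mul_le_of_le_one_right hκ.le (pow_le_one₀ htime0 htime))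
  rw [hD, hGR]
  exact ⟨⟨fun i => (abs_le_sqrt_sum_sq z i).trans (hnorm.trans hbox), fun i => (hz i).2⟩, hnorm⟩
end

section
/- Let H ⊆ ℝ^d be a closed nonempty set, M ≥ 0, and let (g_t)_{t≥1} be a sequence in ℝ^d with running averages f̄_t = (1/t)·Σ_{s=1}^t g_s. Suppose that for every t ≥ 1 there exists a nearest point y_t of f̄_t in H (i.e. ‖f̄_t − y_t‖ = dist(f̄_t, H)) such that ⟨f̄_t − y_t, g_{t+1} − y_t⟩ ≤ 0 and ‖g_{t+1} − y_t‖ ≤ M. Then for every T ≥ 1, dist(f̄_{T+1}, H)² ≤ dist(f̄_1, H)²/(T+1)² + M²/(T+1). In particular dist(f̄_T, H) → 0 as T → ∞. -/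
open scoped RealInnerProductSpace

/-- Updating a running average, scaled by time. -/
lemma add_one_smul_average_succ {E : Type*} [AddCommGroup E] [Module ℝ E] {g fbar : ℕ → E}
    (hf : ∀ t : ℕ, fbar t = (t : ℝ)⁻¹ • ∑ s ∈ Finset.Icc 1 t, g s) {t : ℕ} (ht : 1 ≤ t) :
    ((t : ℝ) + 1) • fbar (t + 1) = (t : ℝ) • fbar t + g (t + 1) := by
  have ht0 : (t : ℝ) ≠ 0 := by positivity
  have ht1 : (t : ℝ) + 1 ≠ 0 := by positivity
  rw [hf (t + 1), hf t, Nat.cast_add_one, smul_inv_smul₀ ht1, smul_inv_smul₀ ht0,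
    Finset.sum_Icc_succ_top (by omega)]

/-- One step of Blackwell's argument: if `x'` is a weighted average of `x` and `g`, and `g` lies
on the other side of the hyperplane through a nearest point `y` of `x`, then the scaled squared
distance to `H` grows by at most `M ^ 2`. -/
lemma sq_mul_infDist_sq_le_add {E : Type*} [NormedAddCommGroup E] [InnerProductSpace ℝ E]
    {H : Set E} {x x' g y : E} {τ M : ℝ} (hτ : 0 ≤ τ) (hx' : (τ + 1) • x' = τ • x + g)
    (hy : y ∈ H) (hxy : ‖x - y‖ = Metric.infDist x H) (hinner : ⟪x - y, g - y⟫ ≤ 0)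
    (hM : ‖g - y‖ ≤ M) :
    (τ + 1) ^ 2 * Metric.infDist x' H ^ 2 ≤ τ ^ 2 * Metric.infDist x H ^ 2 + M ^ 2 := by
  have hdist : Metric.infDist x' H ≤ ‖x' - y‖ := by
    simpa [dist_eq_norm] using Metric.infDist_le_dist_of_mem (x := x') hy
  have hsplit : (τ + 1) • (x' - y) = τ • (x - y) + (g - y) := by
    rw [smul_sub, hx']
    module
  calc (τ + 1) ^ 2 * Metric.infDist x' H ^ 2
      ≤ (τ + 1) ^ 2 * ‖x' - y‖ ^ 2 := by
        gcongr
        exact Metric.infDist_nonneg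
    _ = ‖τ • (x - y) + (g - y)‖ ^ 2 := by
        rw [← hsplit, norm_smul, mul_pow, Real.norm_eq_abs, sq_abs]
    _ = τ ^ 2 * ‖x - y‖ ^ 2 + 2 * (τ * ⟪x - y, g - y⟫) + ‖g - y‖ ^ 2 := by
        rw [norm_add_sq_real, norm_smul, mul_pow, Real.norm_eq_abs, sq_abs, real_inner_smul_left]
    _ ≤ τ ^ 2 * Metric.infDist x H ^ 2 + M ^ 2 := by
        have hcross := mul_nonpos_of_nonneg_of_nonpos hτ hinner
        have hsq : ‖g - y‖ ^ 2 ≤ M ^ 2 := by gcongr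
        rw [← hxy]
        linarith

/-- **Quantitative Blackwell approachability bound (eq. (6.5) of the paper).**
If at every time `t ≥ 1` there is a nearest point `y_t` of the running average `f̄_t`
in the closed set `H` satisfying Blackwell's B-set condition
`⟨f̄_t − y_t, g_{t+1} − y_t⟩ ≤ 0` and `‖g_{t+1} − y_t‖ ≤ M`, then
`dist(f̄_{T+1}, H)² ≤ dist(f̄_1, H)²/(T+1)² + M²/(T+1)` and `dist(f̄_T, H) → 0`. -/
theorem stmt_13 (d : ℕ) (H : Set (EuclideanSpace ℝ (Fin d)))
    (hcl : IsClosed H) (hne : H.Nonempty) (M : ℝ) (hM : 0 ≤ M)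
    (g : ℕ → EuclideanSpace ℝ (Fin d))
    (fbar : ℕ → EuclideanSpace ℝ (Fin d))
    (hf : ∀ t : ℕ, fbar t = ((t : ℝ))⁻¹ • ∑ s ∈ Finset.Icc 1 t, g s)
    (hB : ∀ t : ℕ, 1 ≤ t → ∃ y ∈ H,
      ‖fbar t - y‖ = Metric.infDist (fbar t) H ∧
      ⟪fbar t - y, g (t + 1) - y⟫ ≤ 0 ∧ ‖g (t + 1) - y‖ ≤ M) :
    (∀ T : ℕ, 1 ≤ T →
      Metric.infDist (fbar (T + 1)) H ^ 2 ≤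
        Metric.infDist (fbar 1) H ^ 2 / ((T : ℝ) + 1) ^ 2 + M ^ 2 / ((T : ℝ) + 1)) ∧
    Filter.Tendsto (fun T => Metric.infDist (fbar T) H) Filter.atTop (nhds 0) := by
  have hgrowth : ∀ T : ℕ, ((T : ℝ) + 1) ^ 2 * Metric.infDist (fbar (T + 1)) H ^ 2 ≤
      Metric.infDist (fbar 1) H ^ 2 + T * M ^ 2 := by
    intro T
    induction T with
    | zero => simp
    | succ T ih =>
      obtain ⟨y, hy, hxy, hinner, hle⟩ := hB (T + 1) (by omega)
      have hstep := sq_mul_infDist_sq_le_add (by positivity)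
        (add_one_smul_average_succ hf (by omega)) hy hxy hinner hle
      push_cast at hstep ⊢
      linarith
  have hbound : ∀ T : ℕ, Metric.infDist (fbar (T + 1)) H ^ 2 ≤
      Metric.infDist (fbar 1) H ^ 2 / ((T : ℝ) + 1) ^ 2 + M ^ 2 / ((T : ℝ) + 1) := by
    intro T
    have hT : (0 : ℝ) < (T : ℝ) + 1 := by positivity
    have hsum : Metric.infDist (fbar 1) H ^ 2 / ((T : ℝ) + 1) ^ 2 + M ^ 2 / ((T : ℝ) + 1) =
        (Metric.infDist (fbar 1) H ^ 2 + ((T : ℝ) + 1) * M ^ 2) / ((T : ℝ) + 1) ^ 2 := by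
      field_simp
    rw [hsum, le_div_iff₀ (by positivity)]
    nlinarith [hgrowth T, sq_nonneg M]
  refine ⟨fun T _ => hbound T, ?_⟩
  rw [← Filter.tendsto_add_atTop_iff_nat 1]
  have hinv : Filter.Tendsto (fun T : ℕ => ((T : ℝ) + 1)⁻¹) Filter.atTop (nhds 0) := by
    simpa using tendsto_one_div_add_atTop_nhds_zero_nat (𝕜 := ℝ)
  have hlim : Filter.Tendsto (fun T : ℕ => Metric.infDist (fbar 1) H ^ 2 / ((T : ℝ) + 1) ^ 2 +
      M ^ 2 / ((T : ℝ) + 1)) Filter.atTop (nhds 0) := by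
    simpa [div_eq_mul_inv] using
      ((hinv.pow 2).const_mul (Metric.infDist (fbar 1) H ^ 2)).add (hinv.const_mul (M ^ 2))
  have hsq := squeeze_zero (fun T => sq_nonneg _) hbound hlim
  simpa [Real.sqrt_sq Metric.infDist_nonneg] using hsq.sqrt
end

section
/- Assume m ≥ 2 and let M be a nonempty set of pairs (i,j) with 1 ≤ i < j ≤ m; for each (i,j) ∈ M fix β̃_{ij} ∈ Δ_m supported on coordinates {i,j}, and fix R ∈ ℝ. If R ≤ inf over λ ∈ Δ_M of L(Σ_{(i,j)∈M} λ_{ij}·β̃_{ij}), then for every β ∈ Δ_m, I'_concave(β) ≤ L(β). -/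
/-- `J_a(β) = −log Σ_x Π_i ν^i_a(x)^{β_i}`. -/
noncomputable def Jfun {X : Type*} [Fintype X] {K m : ℕ} (ν : Fin m → Fin K → X → ℝ)
    (a : Fin K) (β : Fin m → ℝ) : ℝ :=
  -Real.log (∑ x, ∏ i, ν i a x ^ β i)

/-- `I(β) = min_a J_a(β)`. -/
noncomputable def Ifun {X : Type*} [Fintype X] {K m : ℕ} (ν : Fin m → Fin K → X → ℝ)
    (β : Fin m → ℝ) : ℝ :=
  ⨅ a : Fin K, Jfun ν a β

/-- `L(β) = max_a J_a(β)`. -/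
noncomputable def Lfun {X : Type*} [Fintype X] {K m : ℕ} (ν : Fin m → Fin K → X → ℝ)
    (β : Fin m → ℝ) : ℝ :=
  ⨆ a : Fin K, Jfun ν a β

/-- The perturbed upper concave envelope `I'_concave(β)` determined by `R`, the set of
perturbed pairs `M` and the perturbation points `β̃`. -/
noncomputable def Iconc {X : Type*} [Fintype X] {K m : ℕ} (ν : Fin m → Fin K → X → ℝ)
    (R : ℝ) (M : Finset (Fin m × Fin m)) (βt : Fin m × Fin m → Fin m → ℝ)
    (β : Fin m → ℝ) : ℝ :=
  sSup {r : ℝ | ∃ (lam : {p // p ∈ M} → ℝ) (lb : ℝ) (β' : Fin m → ℝ),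
    (∀ p, 0 ≤ lam p) ∧ 0 ≤ lb ∧ (∑ p, lam p) + lb = 1 ∧
    β' ∈ stdSimplex ℝ (Fin m) ∧
    β = (fun k => (∑ p : {p // p ∈ M}, lam p * βt p.1 k) + lb * β' k) ∧
    r = R * (∑ p, lam p) + lb * Ifun ν β'}

/-- Hölder's inequality with weights `s + t = 1`, in logarithmic form. -/
lemma log_sum_rpow_mul_rpow_le {X : Type*} [Fintype X] [Nonempty X] {f g : X → ℝ}
    (hf : ∀ x, 0 < f x) (hg : ∀ x, 0 < g x) {s t : ℝ} (hs : 0 ≤ s) (ht : 0 ≤ t)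
    (hst : s + t = 1) :
    Real.log (∑ x, f x ^ s * g x ^ t) ≤
      s * Real.log (∑ x, f x) + t * Real.log (∑ x, g x) := by
  have hF : 0 < ∑ x, f x := Finset.sum_pos (fun x _ => hf x) Finset.univ_nonempty
  have hG : 0 < ∑ x, g x := Finset.sum_pos (fun x _ => hg x) Finset.univ_nonempty
  set F := ∑ x, f x with hFdef
  set G := ∑ x, g x with hGdef
  have hFs : 0 < F ^ s := Real.rpow_pos_of_pos hF s
  have hGt : 0 < G ^ t := Real.rpow_pos_of_pos hG t
  have hsum : ∑ x, f x ^ s * g x ^ t ≤ F ^ s * G ^ t := by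
    have hratio : (∑ x, f x ^ s * g x ^ t) / (F ^ s * G ^ t) ≤ 1 := by
      calc (∑ x, f x ^ s * g x ^ t) / (F ^ s * G ^ t)
          = ∑ x, (f x / F) ^ s * (g x / G) ^ t := by
            rw [Finset.sum_div]
            refine Finset.sum_congr rfl fun x _ => ?_
            rw [Real.div_rpow (hf x).le hF.le, Real.div_rpow (hg x).le hG.le, div_mul_div_comm]
        _ ≤ ∑ x, (s * (f x / F) + t * (g x / G)) :=
            Finset.sum_le_sum fun x _ => Real.geom_mean_le_arith_mean2_weighted hs ht
              (div_pos (hf x) hF).le (div_pos (hg x) hG).le hst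
        _ = 1 := by
            rw [Finset.sum_add_distrib, ← Finset.mul_sum, ← Finset.mul_sum, ← Finset.sum_div,
              ← Finset.sum_div, ← hFdef, ← hGdef, div_self hF.ne', div_self hG.ne', mul_one,
              mul_one, hst]
    exact (div_le_one (mul_pos hFs hGt)).1 hratio
  have hpos : 0 < ∑ x, f x ^ s * g x ^ t :=
    Finset.sum_pos (fun x _ => mul_pos (Real.rpow_pos_of_pos (hf x) s)
      (Real.rpow_pos_of_pos (hg x) t)) Finset.univ_nonempty
  calc Real.log (∑ x, f x ^ s * g x ^ t) ≤ Real.log (F ^ s * G ^ t) := Real.log_le_log hpos hsum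
    _ = s * Real.log F + t * Real.log G := by
      rw [Real.log_mul hFs.ne' hGt.ne', Real.log_rpow hF, Real.log_rpow hG]

section

variable {X : Type*} [Fintype X] {K m : ℕ} {ν : Fin m → Fin K → X → ℝ}

lemma Jfun_concave [Nonempty X] (hfull : ∀ i a x, 0 < ν i a x) (a : Fin K) (β γ : Fin m → ℝ) {s t : ℝ}
    (hs : 0 ≤ s) (ht : 0 ≤ t) (hst : s + t = 1) :
    s * Jfun ν a β + t * Jfun ν a γ ≤ Jfun ν a (fun k => s * β k + t * γ k) := by
  have hprod : ∀ (δ : Fin m → ℝ) x, 0 < ∏ i, ν i a x ^ δ i := fun δ x =>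
    Finset.prod_pos fun i _ => Real.rpow_pos_of_pos (hfull i a x) _
  have hsplit : ∀ x, ∏ i, ν i a x ^ (s * β i + t * γ i) =
      (∏ i, ν i a x ^ β i) ^ s * (∏ i, ν i a x ^ γ i) ^ t := by
    intro x
    rw [← Real.finsetProd_rpow _ _ fun i _ => (Real.rpow_pos_of_pos (hfull i a x) _).le,
      ← Real.finsetProd_rpow _ _ fun i _ => (Real.rpow_pos_of_pos (hfull i a x) _).le,
      ← Finset.prod_mul_distrib]
    refine Finset.prod_congr rfl fun i _ => ?_
    rw [← Real.rpow_mul (hfull i a x).le, ← Real.rpow_mul (hfull i a x).le,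
      Real.rpow_add (hfull i a x), mul_comm s, mul_comm t]
  have hlog := log_sum_rpow_mul_rpow_le (hprod β) (hprod γ) hs ht hst
  simp only [Jfun, hsplit]
  linarith

lemma Jfun_nonneg (hν : ∀ i a, IsPMF (ν i a)) (a : Fin K)
    {β : Fin m → ℝ} (hβ : β ∈ stdSimplex ℝ (Fin m)) : 0 ≤ Jfun ν a β := by
  have hnonneg : 0 ≤ ∑ x, ∏ i, ν i a x ^ β i := Finset.sum_nonneg fun x _ =>
    Finset.prod_nonneg fun i _ => Real.rpow_nonneg ((hν i a).1 x) _
  have hle : ∑ x, ∏ i, ν i a x ^ β i ≤ 1 := by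
    calc ∑ x, ∏ i, ν i a x ^ β i ≤ ∑ x, ∑ i, β i * ν i a x :=
          Finset.sum_le_sum fun x _ => Real.geom_mean_le_arith_mean_weighted _ _ _
            (fun i _ => hβ.1 i) hβ.2 fun i _ => (hν i a).1 x
      _ = 1 := by
          rw [Finset.sum_comm]
          simp_rw [← Finset.mul_sum, (hν _ a).2, mul_one]
          exact hβ.2
  exact neg_nonneg.2 (Real.log_nonpos hnonneg hle)

lemma Lfun_nonneg (hν : ∀ i a, IsPMF (ν i a))
    {β : Fin m → ℝ} (hβ : β ∈ stdSimplex ℝ (Fin m)) : 0 ≤ Lfun ν β :=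
  Real.iSup_nonneg fun a => Jfun_nonneg hν a hβ

lemma Jfun_le_Lfun (a : Fin K) (β : Fin m → ℝ) : Jfun ν a β ≤ Lfun ν β :=
  le_ciSup (Set.finite_range fun a => Jfun ν a β).bddAbove a

lemma Ifun_le_Jfun (a : Fin K) (β : Fin m → ℝ) : Ifun ν β ≤ Jfun ν a β :=
  ciInf_le (Set.finite_range fun a => Jfun ν a β).bddBelow a

/-- If `R ≤ L(γ)`, mixing the value `R` at `γ` with `I(β')` stays below `L` at the mixture. -/
lemma mix_le_Lfun [Nonempty X] [Nonempty (Fin K)] (hfull : ∀ i a x, 0 < ν i a x) {R : ℝ}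
    {γ : Fin m → ℝ} (hγ : R ≤ Lfun ν γ) (β' : Fin m → ℝ) {s t : ℝ} (hs : 0 ≤ s) (ht : 0 ≤ t)
    (hst : s + t = 1) :
    s * R + t * Ifun ν β' ≤ Lfun ν (fun k => s * γ k + t * β' k) := by
  obtain ⟨a, ha⟩ := exists_eq_ciSup_of_finite (f := fun a => Jfun ν a γ)
  have hRa : R ≤ Jfun ν a γ := hγ.trans_eq ha.symm
  calc s * R + t * Ifun ν β' ≤ s * Jfun ν a γ + t * Jfun ν a β' := by
        gcongr
        exact Ifun_le_Jfun a β'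
    _ ≤ Jfun ν a (fun k => s * γ k + t * β' k) := Jfun_concave hfull a γ β' hs ht hst
    _ ≤ _ := Jfun_le_Lfun a _

end

lemma sum_mul_mem_stdSimplex {ι κ : Type*} [Fintype ι] [Fintype κ] {l : ι → ℝ}
    (hl : ∀ i, 0 ≤ l i) (hl1 : ∑ i, l i = 1) {b : ι → κ → ℝ} (hb : ∀ i, b i ∈ stdSimplex ℝ κ) :
    (fun k => ∑ i, l i * b i k) ∈ stdSimplex ℝ κ := by
  refine ⟨fun k => Finset.sum_nonneg fun i _ => mul_nonneg (hl i) ((hb i).1 k), ?_⟩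
  rw [Finset.sum_comm]
  simp_rw [← Finset.mul_sum, (hb _).2, mul_one]
  exact hl1

/-- **Key inequality in the proof of Theorem 10 of the paper.**
If `R ≤ inf_{λ ∈ Δ_M} L(Σ λ_{ij} β̃_{ij})`, then `I'_concave(β) ≤ L(β)` on `Δ_m`. -/
theorem stmt_15 {X : Type*} [Fintype X] [Nonempty X] (K m : ℕ) (hK : 1 ≤ K) (hm : 2 ≤ m)
    (ν : Fin m → Fin K → X → ℝ) (hν : ∀ i a, IsPMF (ν i a))
    (hfull : ∀ i a x, 0 < ν i a x)
    (M : Finset (Fin m × Fin m)) (hMne : M.Nonempty) (hMlt : ∀ p ∈ M, p.1 < p.2)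
    (βt : Fin m × Fin m → Fin m → ℝ)
    (hβt : ∀ p ∈ M, βt p ∈ stdSimplex ℝ (Fin m) ∧
      ∀ k, k ≠ p.1 → k ≠ p.2 → βt p k = 0)
    (R : ℝ)
    (hR : R ≤ ⨅ lam : {l : {p // p ∈ M} → ℝ // (∀ p, 0 ≤ l p) ∧ ∑ p, l p = 1},
      Lfun ν (fun k => ∑ p : {p // p ∈ M}, lam.1 p * βt p.1 k)) :
    ∀ β ∈ stdSimplex ℝ (Fin m), Iconc ν R M βt β ≤ Lfun ν β := by
  intro β hβ
  have : Nonempty (Fin K) := ⟨⟨0, hK⟩⟩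
  have hRL : ∀ l : {p // p ∈ M} → ℝ, (∀ p, 0 ≤ l p) → ∑ p, l p = 1 →
      R ≤ Lfun ν (fun k => ∑ p : {p // p ∈ M}, l p * βt p.1 k) := by
    intro l hl hl1
    refine hR.trans (ciInf_le ⟨0, ?_⟩ (⟨l, hl, hl1⟩ :
      {l : {p // p ∈ M} → ℝ // (∀ p, 0 ≤ l p) ∧ ∑ p, l p = 1}))
    rintro _ ⟨l', rfl⟩
    exact Lfun_nonneg hν (sum_mul_mem_stdSimplex l'.2.1 l'.2.2 fun p => (hβt p.1 p.2).1)
  refine Real.sSup_le ?_ (Lfun_nonneg hν hβ)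
  rintro r ⟨lam, lb, β', hlam, hlb, hsum, -, rfl, rfl⟩
  have hs : 0 ≤ ∑ p, lam p := Finset.sum_nonneg fun p _ => hlam p
  rcases hs.eq_or_lt with hs0 | hspos
  · have hlam0 : ∀ p, lam p = 0 := fun p =>
      (Finset.sum_eq_zero_iff_of_nonneg fun p _ => hlam p).1 hs0.symm p (Finset.mem_univ p)
    have hlb1 : lb = 1 := by linarith
    obtain ⟨a⟩ := this
    simpa [hlam0, hlb1] using (Ifun_le_Jfun a β').trans (Jfun_le_Lfun a β')
  · set s := ∑ p, lam p with hsdef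
    have hγ := hRL (fun p => lam p / s) (fun p => div_nonneg (hlam p) hs)
      (by rw [← Finset.sum_div, ← hsdef, div_self hspos.ne'])
    have hmix := mix_le_Lfun hfull hγ β' hs hlb hsum
    have hpt : ∀ k, s * ∑ p : {p // p ∈ M}, lam p / s * βt p.1 k =
        ∑ p : {p // p ∈ M}, lam p * βt p.1 k := by
      intro k
      rw [Finset.mul_sum]
      refine Finset.sum_congr rfl fun p _ => ?_
      field_simp
    simp only [hpt] at hmix
    rwa [mul_comm R s]
end
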